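/- Let p be an odd prime, n even, 𝒞 ⊆ (ℤ/p)^{2n} a linear code self-dual with respect to η, χ := √p·1_{2n} ∈ Λ(𝒞), δ := χ/2, Λ₀ := {λ ∈ Λ(𝒞) : χ ⊙ λ ∈ 2ℤ}, Λ₁ := {λ ∈ Λ(𝒞) : χ ⊙ λ ∈ 2ℤ+1}; set Λ₂ := Λ₁ + δ and Λ₃ := Λ₀ + δ if n ∈ 4ℤ, and Λ₂ := Λ₀ + δ and Λ₃ := Λ₁ + δ if n ∈ 4ℤ+2. Then for every τ in the upper half-plane: Θ_{Λ₂}(τ) = ½[W_𝒞({ψ̃⁺_{ab}}) − W_𝒞({ψ̃⁻_{ab}})] and Θ_{Λ₃}(τ) = ½[W_𝒞({ψ̃⁺_{ab}}) + W_𝒞({ψ̃⁻_{ab}})], where, with ã, b̃ ∈ {0,…,p−1} the lifts of a, b ∈ ℤ/p, ψ̃⁺_{ab} := Θ_{ã+b̃,p}Θ̄_{ã−b̃−p,p} + Θ_{ã+b̃−p,p}Θ̄_{ã−b̃,p} and ψ̃⁻_{ab} := e^{πi(2ãb̃/p + ã + b̃ − p/2)}(Θ_{ã+b̃,p}Θ̄_{ã−b̃−p,p}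 − Θ_{ã+b̃−p,p}Θ̄_{ã−b̃,p}). -/

import Mathlib

noncomputable section
open scoped BigOperators

/-- The Lorentzian inner product `x ⊙ y = Σᵢ (xᵢ y_{n+i} + x_{n+i} yᵢ)` on `ℝ^{2n}`,
with coordinates indexed by `Fin n ⊕ Fin n` (metric `η = [[0,Iₙ],[Iₙ,0]]`). -/
def lorR {n : ℕ} (x y : Fin n ⊕ Fin n → ℝ) : ℝ :=
  ∑ i : Fin n, (x (Sum.inl i) * y (Sum.inr i) + x (Sum.inr i) * y (Sum.inl i))

/-- The Lorentzian inner product on `(ℤ/p)^{2n}`. -/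
def lorZmod {n p : ℕ} (x y : Fin n ⊕ Fin n → ZMod p) : ZMod p :=
  ∑ i : Fin n, (x (Sum.inl i) * y (Sum.inr i) + x (Sum.inr i) * y (Sum.inl i))

/-- The componentwise lift of a codeword in `(ℤ/p)^{2n}` to `{0,…,p−1}^{2n} ⊆ ℝ^{2n}`. -/
def liftR {n p : ℕ} (c : Fin n ⊕ Fin n → ZMod p) : Fin n ⊕ Fin n → ℝ :=
  fun i => ((c i).val : ℝ)

/-- The Construction A lattice `Λ(𝒞) = {(c̃ + p·m)/√p : c ∈ 𝒞, m ∈ ℤ^{2n}} ⊆ ℝ^{2n}`. -/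
def constrA {n : ℕ} (p : ℕ) (C : Set (Fin n ⊕ Fin n → ZMod p)) : Set (Fin n ⊕ Fin n → ℝ) :=
  {x | ∃ c ∈ C, ∃ m : Fin n ⊕ Fin n → ℤ, x = fun i => (liftR c i + p * m i) / Real.sqrt p}

/-- The dual `L* = {x : x ⊙ l ∈ ℤ for all l ∈ L}` with respect to the Lorentzian
inner product. -/
def dualLor {n : ℕ} (L : Set (Fin n ⊕ Fin n → ℝ)) : Set (Fin n ⊕ Fin n → ℝ) :=
  {x | ∀ l ∈ L, ∃ k : ℤ, lorR x l = (k : ℝ)}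

/-- `q^x := e^{2πiτx}` for real `x`. -/
def qpow (τ : ℂ) (x : ℝ) : ℂ := Complex.exp (2 * Real.pi * Complex.I * τ * x)

/-- `q̄^x := e^{−2πi·conj(τ)·x}` for real `x`. -/
def qbarpow (τ : ℂ) (x : ℝ) : ℂ :=
  Complex.exp (-(2 * Real.pi * Complex.I) * (starRingEnd ℂ τ) * x)

/-- The theta function `Θ_S(τ) = Σ_{λ∈S} q^{|λ₁+λ₂|²/4} q̄^{|λ₁−λ₂|²/4}` of a subset
`S ⊆ ℝ^{2n}`, where `λ = (λ₁, λ₂)`. -/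
def thetaSet {n : ℕ} (S : Set (Fin n ⊕ Fin n → ℝ)) (τ : ℂ) : ℂ :=
  ∑' l : S,
    qpow τ ((∑ i : Fin n, (l.1 (Sum.inl i) + l.1 (Sum.inr i)) ^ 2) / 4) *
      qbarpow τ ((∑ i : Fin n, (l.1 (Sum.inl i) - l.1 (Sum.inr i)) ^ 2) / 4)

/-- The complete weight enumerator `W_𝒞({x_{ab}}) = Σ_{(α,β)∈𝒞} Πᵢ x_{αᵢβᵢ}` of a code
`𝒞 ⊆ (ℤ/p)^{2n}`, evaluated on a family of complex numbers `x`. -/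
def cwe {n p : ℕ} (C : Set (Fin n ⊕ Fin n → ZMod p)) (x : ZMod p → ZMod p → ℂ) : ℂ :=
  ∑' c : C, ∏ i : Fin n, x (c.1 (Sum.inl i)) (c.1 (Sum.inr i))

/-- The theta function `Θ_{m,k}(τ) = Σ_{n∈ℤ} q^{k(n+m/(2k))²}`. -/
def thetaMK (m : ℤ) (k : ℕ) (τ : ℂ) : ℂ :=
  ∑' j : ℤ, qpow τ ((k : ℝ) * ((j : ℝ) + (m : ℝ) / (2 * (k : ℝ))) ^ 2)

/-- The conjugate theta function `Θ̄_{m,k}(τ) = Σ_{n∈ℤ} q̄^{k(n+m/(2k))²}`. -/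
def thetaMKbar (m : ℤ) (k : ℕ) (τ : ℂ) : ℂ :=
  ∑' j : ℤ, qbarpow τ ((k : ℝ) * ((j : ℝ) + (m : ℝ) / (2 * (k : ℝ))) ^ 2)

/-- `Λ₀ = {λ ∈ L : χ ⊙ λ ∈ 2ℤ}`. -/
def lam0 {n : ℕ} (L : Set (Fin n ⊕ Fin n → ℝ)) (χ : Fin n ⊕ Fin n → ℝ) :
    Set (Fin n ⊕ Fin n → ℝ) :=
  {l ∈ L | ∃ k : ℤ, lorR χ l = 2 * (k : ℝ)}

/-- `Λ₁ = {λ ∈ L : χ ⊙ λ ∈ 2ℤ+1}`. -/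
def lam1 {n : ℕ} (L : Set (Fin n ⊕ Fin n → ℝ)) (χ : Fin n ⊕ Fin n → ℝ) :
    Set (Fin n ⊕ Fin n → ℝ) :=
  {l ∈ L | ∃ k : ℤ, lorR χ l = 2 * (k : ℝ) + 1}

/-- The shift `S + v` of a subset `S ⊆ ℝ^{2n}` by the vector `v`. -/
def shiftSet {n : ℕ} (S : Set (Fin n ⊕ Fin n → ℝ)) (v : Fin n ⊕ Fin n → ℝ) :
    Set (Fin n ⊕ Fin n → ℝ) :=
  (· + v) '' S

/-- `ψ̃⁺_{ab} = Θ_{ã+b̃,p}Θ̄_{ã−b̃−p,p} + Θ_{ã+b̃−p,p}Θ̄_{ã−b̃,p}`. -/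
def psiTP {p : ℕ} (a b : ZMod p) (τ : ℂ) : ℂ :=
  thetaMK ((a.val : ℤ) + (b.val : ℤ)) p τ * thetaMKbar ((a.val : ℤ) - (b.val : ℤ) - p) p τ
    + thetaMK ((a.val : ℤ) + (b.val : ℤ) - p) p τ * thetaMKbar ((a.val : ℤ) - (b.val : ℤ)) p τ

/-- `ψ̃⁻_{ab} = e^{πi(2ãb̃/p+ã+b̃−p/2)}(Θ_{ã+b̃,p}Θ̄_{ã−b̃−p,p} − Θ_{ã+b̃−p,p}Θ̄_{ã−b̃,p})`. -/
def psiTM {p : ℕ} (a b : ZMod p) (τ : ℂ) : ℂ :=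
  Complex.exp (Real.pi * Complex.I *
      (2 * (a.val : ℝ) * (b.val : ℝ) / p + (a.val : ℝ) + (b.val : ℝ) - (p : ℝ) / 2)) *
    (thetaMK ((a.val : ℤ) + (b.val : ℤ)) p τ * thetaMKbar ((a.val : ℤ) - (b.val : ℤ) - p) p τ
      - thetaMK ((a.val : ℤ) + (b.val : ℤ) - p) p τ * thetaMKbar ((a.val : ℤ) - (b.val : ℤ)) p τ)

theorem qbarpow_eq_qpow (τ : ℂ) (x : ℝ) : qbarpow τ x = qpow (-(starRingEnd ℂ τ)) x := by
  unfold qbarpow qpow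
  congr 1
  ring

theorem summable_qpow_mul_sq {τ : ℂ} (hτ : 0 < τ.im) {k : ℝ} (hk : 0 < k) (s : ℝ) :
    Summable fun j : ℤ => qpow τ (k * ((j : ℝ) + s) ^ 2) := by
  have h := (summable_jacobiTheta₂_term_iff (2 * τ * k * s) (2 * k * τ)).2 (by
    simp only [Complex.mul_im, Complex.mul_re, Complex.re_ofNat, Complex.im_ofNat,
      Complex.ofReal_re, Complex.ofReal_im]
    nlinarith [mul_pos hk hτ])
  refine (h.mul_left (qpow τ (k * s ^ 2))).congr fun j => ?_
  unfold jacobiTheta₂_term qpow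
  rw [← Complex.exp_add]
  congr 1
  push_cast
  ring

theorem summable_qbarpow_mul_sq {τ : ℂ} (hτ : 0 < τ.im) {k : ℝ} (hk : 0 < k) (s : ℝ) :
    Summable fun j : ℤ => qbarpow τ (k * ((j : ℝ) + s) ^ 2) := by
  simp only [qbarpow_eq_qpow]
  exact summable_qpow_mul_sq (by simpa using hτ) hk s

theorem qpow_sum {ι : Type*} (s : Finset ι) (τ : ℂ) (x : ι → ℝ) :
    qpow τ (∑ i ∈ s, x i) = ∏ i ∈ s, qpow τ (x i) := by
  unfold qpow
  rw [← Complex.exp_sum]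
  push_cast
  rw [Finset.mul_sum]

theorem qbarpow_sum {ι : Type*} (s : Finset ι) (τ : ℂ) (x : ι → ℝ) :
    qbarpow τ (∑ i ∈ s, x i) = ∏ i ∈ s, qbarpow τ (x i) := by
  simp only [qbarpow_eq_qpow, qpow_sum]

theorem hasSum_mul_prod {ι κ : Type*} {f : ι → ℂ} {g : κ → ℂ} {a b : ℂ}
    (hf : HasSum f a) (hg : HasSum g b) : HasSum (fun x : ι × κ => f x.1 * g x.2) (a * b) := by
  have hf' := hf.summable.norm
  have hg' := hg.summable.norm
  rw [← hf.tsum_eq, ← hg.tsum_eq, tsum_mul_tsum_of_summable_norm hf' hg']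
  exact (summable_mul_of_summable_norm hf' hg').hasSum

theorem hasSum_prod_pi {ι : Type*} : ∀ {n : ℕ} {f : Fin n → ι → ℂ} {a : Fin n → ℂ},
    (∀ i, HasSum (f i) (a i)) → HasSum (fun x : Fin n → ι => ∏ i, f i (x i)) (∏ i, a i)
  | 0, f, a, _ => by
    simp
  | n + 1, f, a, h => by
    rw [← (Fin.consEquiv fun _ : Fin (n + 1) => ι).hasSum_iff, Fin.prod_univ_succ]
    have := hasSum_mul_prod (h 0) (hasSum_prod_pi fun i => h (Fin.succ i))
    refine this.congr_fun fun x => ?_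
    simp [Fin.consEquiv, Fin.prod_univ_succ]

theorem hasSum_prod_of_finite {β γ : Type*} [Finite β] {f : β × γ → ℂ} {g : β → ℂ}
    (h : ∀ b, HasSum (fun c => f (b, c)) (g b)) : HasSum f (∑' b, g b) := by
  have hf : Summable f := by
    refine Summable.of_norm ((summable_prod_of_nonneg fun _ => norm_nonneg _).2 ⟨fun b => ?_, ?_⟩)
    · exact (h b).summable.norm
    · exact .of_finite
  have := hf.hasSum.prod_fiberwise h
  rw [this.tsum_eq]
  exact hf.hasSum

/-- The pairs `(m, l)` of integers, split according to the parity of `m + l`. -/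
def parityEquiv : (ℤ × ℤ) ⊕ (ℤ × ℤ) ≃ ℤ × ℤ :=
  Equiv.ofBijective
    (Sum.elim (fun y => (y.1 + y.2 - 1, y.1 - y.2)) (fun y => (y.1 + y.2 - 1, y.1 - y.2 - 1))) <| by
    constructor
    · rintro (⟨a, b⟩ | ⟨a, b⟩) (⟨c, d⟩ | ⟨c, d⟩) h <;>
        simp only [Sum.elim_inl, Sum.elim_inr, Prod.mk.injEq, Sum.inl.injEq, Sum.inr.injEq,
          reduceCtorEq] at h ⊢ <;> omega
    · rintro ⟨m, l⟩
      rcases Int.even_or_odd' (m + l) with ⟨k, hk | hk⟩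
      · exact ⟨Sum.inr (k + 1, m - k), by simp only [Sum.elim_inr, Prod.mk.injEq]; omega⟩
      · exact ⟨Sum.inl (k + 1, m - k), by simp only [Sum.elim_inl, Prod.mk.injEq]; omega⟩

theorem parityEquiv_inl (y : ℤ × ℤ) :
    parityEquiv (Sum.inl y) = (y.1 + y.2 - 1, y.1 - y.2) := rfl

theorem parityEquiv_inr (y : ℤ × ℤ) :
    parityEquiv (Sum.inr y) = (y.1 + y.2 - 1, y.1 - y.2 - 1) := rfl

/-- The contribution of one pair of coordinates `(a + p m, b + p l)`, shifted by `δ`, to the theta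
function of a shifted Construction A lattice. -/
def coordWeight (p : ℕ) (τ : ℂ) (a b : ℤ) (x : ℤ × ℤ) : ℂ :=
  qpow τ ((a + b + p * (x.1 + x.2 + 1)) ^ 2 / (4 * p)) *
    qbarpow τ ((a - b + p * (x.1 - x.2)) ^ 2 / (4 * p))

theorem hasSum_mul_coordWeight {p : ℕ} (hp : 0 < p) {τ : ℂ} (hτ : 0 < τ.im) (a b : ℤ)
    {w : ℤ × ℤ → ℂ} {u v : ℂ} (hu : ∀ x, w (parityEquiv (Sum.inl x)) = u)
    (hv : ∀ x, w (parityEquiv (Sum.inr x)) = v) :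
    HasSum (fun x => w x * coordWeight p τ a b x)
      (u * (thetaMK (a + b) p τ * thetaMKbar (a - b - p) p τ) +
        v * (thetaMK (a + b - p) p τ * thetaMKbar (a - b) p τ)) := by
  have hp' : (0 : ℝ) < p := by exact_mod_cast hp
  rw [← parityEquiv.hasSum_iff]
  refine HasSum.sum ?_ ?_
  · have := (hasSum_mul_prod
      (summable_qpow_mul_sq hτ hp' (((a + b : ℤ) : ℝ) / (2 * (p : ℝ)))).hasSum
      (summable_qbarpow_mul_sq hτ hp' (((a - b - p : ℤ) : ℝ) / (2 * (p : ℝ)))).hasSum).mul_left u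
    refine this.congr_fun fun x => ?_
    simp only [Function.comp_apply, hu, coordWeight]
    congr 3
    · rw [parityEquiv_inl]
      push_cast
      field_simp
      ring
    · rw [parityEquiv_inl]
      push_cast
      field_simp
      ring
  · have := (hasSum_mul_prod
      (summable_qpow_mul_sq hτ hp' (((a + b - p : ℤ) : ℝ) / (2 * (p : ℝ)))).hasSum
      (summable_qbarpow_mul_sq hτ hp' (((a - b : ℤ) : ℝ) / (2 * (p : ℝ)))).hasSum).mul_left v
    refine this.congr_fun fun x => ?_
    simp only [Function.comp_apply, hv, coordWeight]
    congr 3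
    · rw [parityEquiv_inr]
      push_cast
      field_simp
      ring
    · rw [parityEquiv_inr]
      push_cast
      field_simp
      ring

theorem hasSum_coordWeight {p : ℕ} [NeZero p] {τ : ℂ} (hτ : 0 < τ.im) (a b : ZMod p) :
    HasSum (coordWeight p τ a.val b.val) (psiTP a b τ) := by
  have := hasSum_mul_coordWeight (NeZero.pos p) hτ a.val b.val (w := 1) (u := 1) (v := 1)
    (fun _ => rfl) (fun _ => rfl)
  simpa [psiTP] using this

/-- The weight `-(-1)^{ã+b̃} (Θ_{ã+b̃,p}Θ̄_{ã−b̃−p,p} − Θ_{ã+b̃−p,p}Θ̄_{ã−b̃,p})`, the sum of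
`coordWeight` against the sign of the grading. -/
def psiSigned {p : ℕ} (a b : ZMod p) (τ : ℂ) : ℂ :=
  -(-1 : ℂ) ^ ((a.val : ℤ) + b.val) *
    (thetaMK ((a.val : ℤ) + (b.val : ℤ)) p τ * thetaMKbar ((a.val : ℤ) - (b.val : ℤ) - p) p τ
      - thetaMK ((a.val : ℤ) + (b.val : ℤ) - p) p τ * thetaMKbar ((a.val : ℤ) - (b.val : ℤ)) p τ)

theorem hasSum_neg_one_zpow_mul_coordWeight {p : ℕ} (hp : Odd p) {τ : ℂ} (hτ : 0 < τ.im)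
    (a b : ZMod p) :
    HasSum (fun x : ℤ × ℤ => (-1 : ℂ) ^ ((a.val : ℤ) + b.val + p * (x.1 + x.2)) *
      coordWeight p τ a.val b.val x) (psiSigned a b τ) := by
  have hp' : Odd (p : ℤ) := by exact_mod_cast hp
  have h := hasSum_mul_coordWeight hp.pos hτ a.val b.val
    (w := fun x : ℤ × ℤ => (-1 : ℂ) ^ ((a.val : ℤ) + b.val + p * (x.1 + x.2)))
    (u := -(-1 : ℂ) ^ ((a.val : ℤ) + b.val)) (v := (-1 : ℂ) ^ ((a.val : ℤ) + b.val))
    (fun x => ?_) (fun x => ?_)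
  · convert h using 1
    rw [psiSigned]
    ring
  · have : Odd ((p : ℤ) * (x.1 + x.2 - 1 + (x.1 - x.2))) := hp'.mul ⟨x.1 - 1, by ring⟩
    rw [parityEquiv_inl, zpow_add₀ (by norm_num), this.neg_one_zpow]
    ring
  · have : Even ((p : ℤ) * (x.1 + x.2 - 1 + (x.1 - x.2 - 1))) :=
      Even.mul_left ⟨x.1 - 1, by ring⟩ _
    rw [parityEquiv_inr, zpow_add₀ (by norm_num), this.neg_one_zpow, mul_one]

/-- The point of the Construction A lattice over the codeword `c` with integer part `x`. -/
def codePoint {n p : ℕ} (c : Fin n ⊕ Fin n → ZMod p) (x : Fin n → ℤ × ℤ) : Fin n ⊕ Fin n → ℝ :=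
  Sum.elim (fun i => (((c (Sum.inl i)).val : ℝ) + p * (x i).1) / Real.sqrt p)
    (fun i => (((c (Sum.inr i)).val : ℝ) + p * (x i).2) / Real.sqrt p)

theorem val_add_mul_inj {p : ℕ} [NeZero p] {a b : ZMod p} {m l : ℤ}
    (h : ((a.val : ℝ) + p * m) / Real.sqrt p = ((b.val : ℝ) + p * l) / Real.sqrt p) :
    a = b ∧ m = l := by
  have hp : (0 : ℝ) < p := by exact_mod_cast NeZero.pos p
  rw [div_left_inj' (Real.sqrt_pos.2 hp).ne'] at h
  have h' : (a.val : ℤ) + p * m = b.val + p * l := by exact_mod_cast h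
  have hab : a = b := by simpa using congrArg (Int.cast : ℤ → ZMod p) h'
  subst hab
  exact ⟨rfl, by simpa [NeZero.ne p] using h'⟩

theorem codePoint_injective {n p : ℕ} [NeZero p] :
    Function.Injective fun z : (Fin n ⊕ Fin n → ZMod p) × (Fin n → ℤ × ℤ) =>
      codePoint z.1 z.2 := by
  rintro ⟨c, x⟩ ⟨d, y⟩ h
  have hl i := val_add_mul_inj (congrFun h (Sum.inl i))
  have hr i := val_add_mul_inj (congrFun h (Sum.inr i))
  refine Prod.ext (funext ?_) (funext fun i => Prod.ext (hl i).2 (hr i).2)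
  rintro (i | i)
  exacts [(hl i).1, (hr i).1]

theorem mem_constrA_iff {n p : ℕ} {C : Set (Fin n ⊕ Fin n → ZMod p)} {v : Fin n ⊕ Fin n → ℝ} :
    v ∈ constrA p C ↔ ∃ z : C × (Fin n → ℤ × ℤ), codePoint z.1.1 z.2 = v := by
  constructor
  · rintro ⟨c, hc, m, rfl⟩
    refine ⟨(⟨c, hc⟩, fun i => (m (Sum.inl i), m (Sum.inr i))), funext ?_⟩
    rintro (i | i) <;> rfl
  · rintro ⟨⟨⟨c, hc⟩, x⟩, rfl⟩
    refine ⟨c, hc, Sum.elim (fun i => (x i).1) (fun i => (x i).2), funext ?_⟩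
    rintro (i | i) <;> rfl

/-- The integer `√p 1_{2n} ⊙ codePoint c x`. -/
def gradeInt {n p : ℕ} (c : Fin n ⊕ Fin n → ZMod p) (x : Fin n → ℤ × ℤ) : ℤ :=
  ∑ i, (((c (Sum.inl i)).val : ℤ) + (c (Sum.inr i)).val + p * ((x i).1 + (x i).2))

theorem lorR_codePoint {n p : ℕ} [NeZero p] (c : Fin n ⊕ Fin n → ZMod p) (x : Fin n → ℤ × ℤ) :
    lorR (fun _ => Real.sqrt p) (codePoint c x) = gradeInt c x := by
  have hp : Real.sqrt p ≠ 0 := (Real.sqrt_pos.2 (by exact_mod_cast NeZero.pos p)).ne'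
  unfold lorR gradeInt
  push_cast
  refine Finset.sum_congr rfl fun i _ => ?_
  simp only [codePoint, Sum.elim_inl, Sum.elim_inr]
  field_simp
  ring

theorem lam0_constrA {n p : ℕ} [NeZero p] (C : Set (Fin n ⊕ Fin n → ZMod p)) :
    lam0 (constrA p C) (fun _ => Real.sqrt p) =
      (fun z : C × (Fin n → ℤ × ℤ) => codePoint z.1.1 z.2) '' {z | Even (gradeInt z.1.1 z.2)} := by
  ext v
  constructor
  · rintro ⟨hv, k, hk⟩
    obtain ⟨z, rfl⟩ := mem_constrA_iff.1 hv
    rw [lorR_codePoint] at hk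
    exact ⟨z, even_iff_exists_two_mul.2 ⟨k, by exact_mod_cast hk⟩, rfl⟩
  · rintro ⟨z, hz, rfl⟩
    obtain ⟨k, hk⟩ := even_iff_exists_two_mul.1 hz
    exact ⟨mem_constrA_iff.2 ⟨z, rfl⟩, k, by rw [lorR_codePoint, hk]; push_cast; ring⟩

theorem lam1_constrA {n p : ℕ} [NeZero p] (C : Set (Fin n ⊕ Fin n → ZMod p)) :
    lam1 (constrA p C) (fun _ => Real.sqrt p) =
      (fun z : C × (Fin n → ℤ × ℤ) => codePoint z.1.1 z.2) '' {z | Odd (gradeInt z.1.1 z.2)} := by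
  ext v
  constructor
  · rintro ⟨hv, k, hk⟩
    obtain ⟨z, rfl⟩ := mem_constrA_iff.1 hv
    rw [lorR_codePoint] at hk
    exact ⟨z, ⟨k, by exact_mod_cast hk⟩, rfl⟩
  · rintro ⟨z, ⟨k, hk⟩, rfl⟩
    exact ⟨mem_constrA_iff.2 ⟨z, rfl⟩, k, by rw [lorR_codePoint, hk]; push_cast; ring⟩

theorem thetaSet_shiftSet_image {n p : ℕ} [NeZero p] (C : Set (Fin n ⊕ Fin n → ZMod p))
    (P : Set (C × (Fin n → ℤ × ℤ))) (τ : ℂ) :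
    thetaSet (shiftSet ((fun z : C × (Fin n → ℤ × ℤ) => codePoint z.1.1 z.2) '' P)
        ((2 : ℝ)⁻¹ • fun _ => Real.sqrt p)) τ =
      ∑' z, P.indicator (fun z => ∏ i, coordWeight p τ (z.1.1 (Sum.inl i)).val
        (z.1.1 (Sum.inr i)).val (z.2 i)) z := by
  have hp : (0 : ℝ) < p := by exact_mod_cast NeZero.pos p
  have hinj : Set.InjOn (fun z : C × (Fin n → ℤ × ℤ) =>
      codePoint z.1.1 z.2 + ((2 : ℝ)⁻¹ • fun _ => Real.sqrt p)) P := fun z _ w _ h => by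
    have := codePoint_injective (a₁ := (z.1.1, z.2)) (a₂ := (w.1.1, w.2)) (add_right_cancel h)
    rw [Prod.mk.injEq] at this
    exact Prod.ext (Subtype.ext this.1) this.2
  unfold thetaSet shiftSet
  rw [Set.image_image, tsum_image (fun l : Fin n ⊕ Fin n → ℝ =>
    qpow τ ((∑ i : Fin n, (l (Sum.inl i) + l (Sum.inr i)) ^ 2) / 4) *
      qbarpow τ ((∑ i : Fin n, (l (Sum.inl i) - l (Sum.inr i)) ^ 2) / 4)) hinj, ← tsum_subtype]
  refine tsum_congr fun z => ?_
  simp only [coordWeight]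
  rw [Finset.sum_div, Finset.sum_div, qpow_sum, qbarpow_sum, ← Finset.prod_mul_distrib]
  have hs : Real.sqrt p ≠ 0 := (Real.sqrt_pos.2 hp).ne'
  have hs2 : Real.sqrt p ^ 2 = p := Real.sq_sqrt hp.le
  refine Finset.prod_congr rfl fun i _ => ?_
  simp only [codePoint, Pi.add_apply, Pi.smul_apply, Sum.elim_inl, Sum.elim_inr, smul_eq_mul]
  generalize Real.sqrt p = s at hs hs2 ⊢
  congr 2
  · push_cast
    rw [← hs2]
    field_simp
    ring
  · push_cast
    rw [← hs2]
    field_simp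
    ring

theorem neg_one_zpow_gradeInt {n p : ℕ} (c : Fin n ⊕ Fin n → ZMod p) (x : Fin n → ℤ × ℤ) :
    (-1 : ℂ) ^ gradeInt c x = ∏ i, (-1 : ℂ) ^ (((c (Sum.inl i)).val : ℤ) + (c (Sum.inr i)).val
      + p * ((x i).1 + (x i).2)) := by
  unfold gradeInt
  induction (Finset.univ : Finset (Fin n)) using Finset.cons_induction with
  | empty => simp
  | cons i s hi ih => rw [Finset.sum_cons, Finset.prod_cons, zpow_add₀ (by norm_num), ih]

theorem thetaSet_shift_lam {n p : ℕ} [NeZero p] (hp : Odd p) (C : Set (Fin n ⊕ Fin n → ZMod p))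
    {τ : ℂ} (hτ : 0 < τ.im) :
    thetaSet (shiftSet (lam0 (constrA p C) fun _ => Real.sqrt p)
        ((2 : ℝ)⁻¹ • fun _ => Real.sqrt p)) τ =
      (cwe C (fun a b => psiTP a b τ) + cwe C (fun a b => psiSigned a b τ)) / 2 ∧
    thetaSet (shiftSet (lam1 (constrA p C) fun _ => Real.sqrt p)
        ((2 : ℝ)⁻¹ • fun _ => Real.sqrt p)) τ =
      (cwe C (fun a b => psiTP a b τ) - cwe C (fun a b => psiSigned a b τ)) / 2 := by
  have h1 : HasSum (fun z : C × (Fin n → ℤ × ℤ) => ∏ i, coordWeight p τ (z.1.1 (Sum.inl i)).val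
      (z.1.1 (Sum.inr i)).val (z.2 i)) (cwe C fun a b => psiTP a b τ) :=
    hasSum_prod_of_finite fun c => hasSum_prod_pi
      (f := fun i => coordWeight p τ (c.1 (Sum.inl i)).val (c.1 (Sum.inr i)).val)
      fun i => hasSum_coordWeight hτ (c.1 (Sum.inl i)) (c.1 (Sum.inr i))
  have h2 : HasSum (fun z : C × (Fin n → ℤ × ℤ) => (-1 : ℂ) ^ gradeInt z.1.1 z.2 *
      ∏ i, coordWeight p τ (z.1.1 (Sum.inl i)).val (z.1.1 (Sum.inr i)).val (z.2 i))
      (cwe C fun a b => psiSigned a b τ) := by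
    simp only [neg_one_zpow_gradeInt, ← Finset.prod_mul_distrib]
    exact hasSum_prod_of_finite fun c => hasSum_prod_pi
      (f := fun i (x : ℤ × ℤ) => (-1 : ℂ) ^ (((c.1 (Sum.inl i)).val : ℤ) + (c.1 (Sum.inr i)).val +
        p * (x.1 + x.2)) * coordWeight p τ (c.1 (Sum.inl i)).val (c.1 (Sum.inr i)).val x)
      fun i => hasSum_neg_one_zpow_mul_coordWeight hp hτ (c.1 (Sum.inl i)) (c.1 (Sum.inr i))
  rw [lam0_constrA, lam1_constrA, thetaSet_shiftSet_image, thetaSet_shiftSet_image]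
  constructor
  · refine (((h1.add h2).div_const 2).congr_fun fun z => ?_).tsum_eq
    by_cases hz : Even (gradeInt z.1.1 z.2)
    · rw [Set.indicator_of_mem (by exact hz), hz.neg_one_zpow]
      ring
    · rw [Set.indicator_of_notMem (by exact hz), (Int.not_even_iff_odd.1 hz).neg_one_zpow]
      ring
  · refine (((h1.sub h2).div_const 2).congr_fun fun z => ?_).tsum_eq
    by_cases hz : Odd (gradeInt z.1.1 z.2)
    · rw [Set.indicator_of_mem (by exact hz), hz.neg_one_zpow]
      ring
    · rw [Set.indicator_of_notMem (by exact hz), (Int.not_odd_iff_even.1 hz).neg_one_zpow]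
      ring

theorem dvd_sum_val_mul_val {n p : ℕ} [NeZero p] (hodd : Odd p)
    {c : Fin n ⊕ Fin n → ZMod p} (hc : lorZmod c c = 0) :
    p ∣ ∑ i, (c (Sum.inl i)).val * (c (Sum.inr i)).val := by
  have h : p ∣ 2 * ∑ i, (c (Sum.inl i)).val * (c (Sum.inr i)).val := by
    rw [← ZMod.natCast_eq_zero_iff, ← hc, lorZmod]
    push_cast
    simp only [ZMod.natCast_val, ZMod.cast_id', id_eq]
    rw [Finset.mul_sum]
    exact Finset.sum_congr rfl fun i _ => by ring
  exact (Nat.Coprime.dvd_mul_left (Nat.coprime_two_right.2 hodd)).1 h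

theorem prod_psiTM {n p : ℕ} [NeZero p] (hne : Even n)
    {c : Fin n ⊕ Fin n → ZMod p} (hc : p ∣ ∑ i, (c (Sum.inl i)).val * (c (Sum.inr i)).val)
    (τ : ℂ) :
    ∏ i, psiTM (c (Sum.inl i)) (c (Sum.inr i)) τ =
      Complex.exp (-(Real.pi * Complex.I * p / 2)) ^ n *
        ∏ i, psiSigned (c (Sum.inl i)) (c (Sum.inr i)) τ := by
  have hp : (p : ℂ) ≠ 0 := by exact_mod_cast NeZero.ne p
  have hterm (a b : ZMod p) : psiTM a b τ = Complex.exp (2 * Real.pi * Complex.I / p *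
      ((a.val * b.val : ℕ) : ℂ)) * (-1) * Complex.exp (-(Real.pi * Complex.I * p / 2)) *
      psiSigned a b τ := by
    have h1 : (-1 : ℂ) ^ ((a.val : ℤ) + b.val) =
        Complex.exp (((a.val + b.val : ℕ) : ℂ) * (Real.pi * Complex.I)) := by
      rw [Complex.exp_nat_mul, Complex.exp_pi_mul_I]
      exact_mod_cast rfl
    rw [psiTM, psiSigned, h1]
    have h2 : Complex.exp (Real.pi * Complex.I *
      (2 * (a.val : ℝ) * (b.val : ℝ) / p + (a.val : ℝ) + (b.val : ℝ) - (p : ℝ) / 2)) =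
      Complex.exp (2 * Real.pi * Complex.I / p * ((a.val * b.val : ℕ) : ℂ)) *
        Complex.exp (-(Real.pi * Complex.I * p / 2)) *
        Complex.exp (((a.val + b.val : ℕ) : ℂ) * (Real.pi * Complex.I)) := by
      rw [← Complex.exp_add, ← Complex.exp_add]
      congr 1
      push_cast
      field_simp
      ring
    rw [h2]
    ring
  simp only [hterm]
  rw [Finset.prod_mul_distrib, Finset.prod_mul_distrib, Finset.prod_mul_distrib,
    ← Complex.exp_sum, ← Finset.mul_sum, ← Nat.cast_sum, Finset.prod_const, Finset.prod_const,
    Finset.card_univ, Fintype.card_fin, hne.neg_one_pow]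
  obtain ⟨k, hk⟩ := hc
  have : Complex.exp (2 * Real.pi * Complex.I / p * ((p * k : ℕ) : ℂ)) = 1 := by
    rw [Complex.exp_eq_one_iff]
    exact ⟨k, by push_cast; field_simp⟩
  rw [hk, this]
  ring

theorem exp_neg_pi_mul_div_two_pow_of_mod_four_eq_zero {n : ℕ} (h : n % 4 = 0) (p : ℕ) :
    Complex.exp (-(Real.pi * Complex.I * p / 2)) ^ n = 1 := by
  obtain ⟨k, rfl⟩ := Nat.dvd_of_mod_eq_zero h
  rw [← Complex.exp_nat_mul, Complex.exp_eq_one_iff]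
  exact ⟨-(p * k), by push_cast; ring⟩

theorem exp_neg_pi_mul_div_two_pow_of_mod_four_eq_two {n p : ℕ} (h : n % 4 = 2) (hp : Odd p) :
    Complex.exp (-(Real.pi * Complex.I * p / 2)) ^ n = -1 := by
  have h2 : Complex.exp (-(Real.pi * Complex.I * p / 2)) ^ 2 = -1 := by
    rw [← Complex.exp_nat_mul, show ((2 : ℕ) : ℂ) * -(Real.pi * Complex.I * p / 2) =
      -(p * (Real.pi * Complex.I)) by push_cast; ring, Complex.exp_neg, Complex.exp_nat_mul,
      Complex.exp_pi_mul_I, hp.neg_one_pow]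
    norm_num
  have hodd : Odd (n / 2) := Nat.odd_iff.2 (by omega)
  rw [show n = 2 * (n / 2) by omega, pow_mul, h2, hodd.neg_one_pow]

/-- Let `p` be an odd prime, `n` even, `𝒞 ⊆ (ℤ/p)^{2n}` a linear code self-dual with
respect to `η`, `χ := √p·1_{2n}`, `δ := χ/2`, and `Λ₀, Λ₁` the `Z₂`-graded parts of
`Λ(𝒞)`; set `Λ₂ := Λ₁ + δ`, `Λ₃ := Λ₀ + δ` if `n ∈ 4ℤ`, and `Λ₂ := Λ₀ + δ`,
`Λ₃ := Λ₁ + δ` if `n ∈ 4ℤ+2`. Then for every `τ` in the upper half-plane,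
`Θ_{Λ₂}(τ) = ½[W_𝒞({ψ̃⁺}) − W_𝒞({ψ̃⁻})]` and `Θ_{Λ₃}(τ) = ½[W_𝒞({ψ̃⁺}) + W_𝒞({ψ̃⁻})]`. -/
theorem statement15 {n p : ℕ} (hn : 1 ≤ n) (hp : p.Prime) (hodd : Odd p) (hne : 2 ∣ n)
    (C : Submodule (ZMod p) (Fin n ⊕ Fin n → ZMod p))
    (hsd : (C : Set (Fin n ⊕ Fin n → ZMod p)) = {v | ∀ c ∈ C, lorZmod v c = 0})
    (χ δ : Fin n ⊕ Fin n → ℝ)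
    (hχ : χ = fun _ => Real.sqrt p) (hδ : δ = (2 : ℝ)⁻¹ • χ)
    (Λ₂ Λ₃ : Set (Fin n ⊕ Fin n → ℝ))
    (hcase0 : n % 4 = 0 →
      Λ₂ = shiftSet (lam1 (constrA p (C : Set (Fin n ⊕ Fin n → ZMod p))) χ) δ ∧
      Λ₃ = shiftSet (lam0 (constrA p (C : Set (Fin n ⊕ Fin n → ZMod p))) χ) δ)
    (hcase2 : n % 4 = 2 →
      Λ₂ = shiftSet (lam0 (constrA p (C : Set (Fin n ⊕ Fin n → ZMod p))) χ) δ ∧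
      Λ₃ = shiftSet (lam1 (constrA p (C : Set (Fin n ⊕ Fin n → ZMod p))) χ) δ)
    (τ : ℂ) (hτ : 0 < τ.im) :
    thetaSet Λ₂ τ =
        (cwe (C : Set (Fin n ⊕ Fin n → ZMod p)) (fun a b => psiTP a b τ)
          - cwe (C : Set (Fin n ⊕ Fin n → ZMod p)) (fun a b => psiTM a b τ)) / 2 ∧
      thetaSet Λ₃ τ =
        (cwe (C : Set (Fin n ⊕ Fin n → ZMod p)) (fun a b => psiTP a b τ)
          + cwe (C : Set (Fin n ⊕ Fin n → ZMod p)) (fun a b => psiTM a b τ)) / 2 := by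
  have : NeZero p := ⟨hp.ne_zero⟩
  subst hχ hδ
  have hcwe : cwe (C : Set (Fin n ⊕ Fin n → ZMod p)) (fun a b => psiTM a b τ) =
      Complex.exp (-(Real.pi * Complex.I * p / 2)) ^ n *
        cwe (C : Set (Fin n ⊕ Fin n → ZMod p)) (fun a b => psiSigned a b τ) := by
    rw [cwe, cwe, ← tsum_mul_left]
    refine tsum_congr fun c => prod_psiTM (even_iff_two_dvd.2 hne) ?_ τ
    have hc : c.1 ∈ {v | ∀ c ∈ C, lorZmod v c = 0} := hsd ▸ c.2
    exact dvd_sum_val_mul_val hodd (hc c.1 c.2)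
  obtain ⟨h0, h1⟩ := thetaSet_shift_lam hodd (C : Set (Fin n ⊕ Fin n → ZMod p)) hτ
  rcases (by omega : n % 4 = 0 ∨ n % 4 = 2) with h | h
  · obtain ⟨rfl, rfl⟩ := hcase0 h
    rw [h0, h1, hcwe, exp_neg_pi_mul_div_two_pow_of_mod_four_eq_zero h, one_mul]
    exact ⟨rfl, rfl⟩
  · obtain ⟨rfl, rfl⟩ := hcase2 h
    rw [h0, h1, hcwe, exp_neg_pi_mul_div_two_pow_of_mod_four_eq_two h hodd]
    constructor <;> ring
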